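/- arXiv:2408.16657 — 4 statements merged into one kernel-verified Lean document; each statement's English description precedes it below -/
import Mathlib

section
/- Let A be a unital C*-algebra and Ω a compact subset of ℂ. Let (xₙ) be a sequence of normal elements of A and x a normal element of A, all with spectra contained in Ω. If d_U(xₙ, x) → 0, then d_W(xₙ, x) → 0; that is, for every ε > 0 there exists N such that d_W(xₙ, x) < ε for all n ≥ N. -/
open Filter Topology
open scoped ENNReal

/-- Cuntz subequivalence of elements of a C*-algebra: `a ≾ b` iff there is a sequence `rₙ`
with `‖rₙ* b rₙ - a‖ → 0`. -/
def CuntzLE {A : Type*} [NonUnitalNormedRing A] [StarRing A] (a b : A) : Prop :=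
  ∃ r : ℕ → A, Tendsto (fun n => ‖star (r n) * b * r n - a‖) atTop (nhds 0)

/-- `O` is a relatively open subset of `Ω`. -/
def RelOpen (Ω O : Set ℂ) : Prop := ∃ U : Set ℂ, IsOpen U ∧ O = U ∩ Ω

/-- The function `f_O : ℂ → ℂ`, equal to `min 1 (dist z (Ω \ O))` (with the convention that the
distance to the empty set is `∞`); its restriction to `Ω` is supported exactly on `O`. -/
noncomputable def fOFun (Ω O : Set ℂ) : ℂ → ℂ :=
  fun z => (((min 1 (EMetric.infEdist z (Ω \ O))).toReal : ℝ) : ℂ)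

/-- `O_r = {x ∈ Ω | dist (x, O) < r}`. -/
def thicken (Ω O : Set ℂ) (r : ℝ) : Set ℂ := {x | x ∈ Ω ∧ Metric.infDist x O < r}

variable {A : Type*} [CStarAlgebra A]

/-- `f_O(x)` for a normal element `x`, via the continuous functional calculus. -/
noncomputable def fOApp (Ω O : Set ℂ) (x : A) : A := cfc (fOFun Ω O) x

/-- The Cuntz distance `d_W` between normal elements with spectra contained in `Ω`, with values
in `[0, ∞]` (the infimum of the empty set being `∞`). -/
noncomputable def dWNormal (Ω : Set ℂ) (x y : A) : ℝ≥0∞ :=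
  sInf {e : ℝ≥0∞ | ∃ r : ℝ, 0 < r ∧ e = ENNReal.ofReal r ∧
    ∀ O : Set ℂ, RelOpen Ω O →
      CuntzLE (fOApp Ω O x) (fOApp Ω (thicken Ω O r) y) ∧
      CuntzLE (fOApp Ω O y) (fOApp Ω (thicken Ω O r) x)}

/-- The distance between the unitary orbits of `x` and `y`. -/
noncomputable def dU (x y : A) : ℝ :=
  sInf {d : ℝ | ∃ u : unitary A, d = ‖(u : A) * x * star (u : A) - y‖}

open Metric

theorem cuntzLE_conj_left {a b : A} (u : unitary A) (h : CuntzLE ((u : A) * a * star (u : A)) b) :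
    CuntzLE a b := by
  obtain ⟨r, hr⟩ := h
  refine ⟨fun n => r n * u, hr.congr fun n => ?_⟩
  have hu : star (u : A) * u = 1 := Unitary.coe_star_mul_self u
  have h1 : star (r n * (u : A)) * b * (r n * u) - a =
      star (u : A) * (star (r n) * b * r n - u * a * star (u : A)) * u := by
    calc star (r n * (u : A)) * b * (r n * u) - a
        = star (u : A) * (star (r n) * b * r n) * u
            - (star (u : A) * u) * a * (star (u : A) * u) := by
          rw [hu, star_mul]; noncomm_ring
      _ = _ := by noncomm_ring
  rw [h1, CStarRing.norm_mul_coe_unitary, ← Unitary.coe_star, CStarRing.norm_coe_unitary_mul]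

theorem cuntzLE_conj_right {a b : A} (u : unitary A)
    (h : CuntzLE a ((u : A) * b * star (u : A))) : CuntzLE a b := by
  obtain ⟨r, hr⟩ := h
  refine ⟨fun n => star (u : A) * r n, hr.congr fun n => ?_⟩
  simp only [star_mul, star_star, mul_assoc]

/-- Compressing the square of a positive element `w` by `(w + ε)^(-1/2)` recovers `w` up to `ε`. -/
theorem exists_norm_mul_sq_mul_sub_le {w : A} (hwsa : IsSelfAdjoint w)
    (hsp : ∀ t ∈ spectrum ℝ w, 0 ≤ t) {ε : ℝ} (hε : 0 < ε) :
    ∃ h : A, IsSelfAdjoint h ∧ ‖h * w * w * h - w‖ ≤ ε := by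
  have hφ : ContinuousOn (fun t : ℝ => (√(t + ε))⁻¹) (spectrum ℝ w) := by
    refine ContinuousOn.inv₀ (by fun_prop) fun t ht => ?_
    have := hsp t ht
    positivity
  refine ⟨cfc (fun t : ℝ => (√(t + ε))⁻¹) w, cfc_predicate _ _, ?_⟩
  set h := cfc (fun t : ℝ => (√(t + ε))⁻¹) w
  have hid : h * w * w * h - w =
      cfc (fun t : ℝ => (√(t + ε))⁻¹ * t * t * (√(t + ε))⁻¹ - t) w := by
    rw [cfc_sub (fun t : ℝ => (√(t + ε))⁻¹ * t * t * (√(t + ε))⁻¹) (fun t => t) w,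
      cfc_mul (fun t : ℝ => (√(t + ε))⁻¹ * t * t) (fun t => (√(t + ε))⁻¹) w,
      cfc_mul (fun t : ℝ => (√(t + ε))⁻¹ * t) (fun t => t) w,
      cfc_mul (fun t : ℝ => (√(t + ε))⁻¹) (fun t => t) w, cfc_id' ℝ w]
  rw [hid]
  refine norm_cfc_le hε.le fun t ht => ?_
  have ht0 := hsp t ht
  have hpos : 0 < t + ε := by linarith
  have hval : (√(t + ε))⁻¹ * t * t * (√(t + ε))⁻¹ - t = -(t * ε / (t + ε)) := by
    have hs : (√(t + ε))⁻¹ * (√(t + ε))⁻¹ = (t + ε)⁻¹ := by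
      rw [← mul_inv, Real.mul_self_sqrt hpos.le]
    calc (√(t + ε))⁻¹ * t * t * (√(t + ε))⁻¹ - t
        = ((√(t + ε))⁻¹ * (√(t + ε))⁻¹) * (t * t) - t := by ring
      _ = _ := by rw [hs]; field_simp; ring
  rw [hval, norm_neg, Real.norm_eq_abs, abs_of_nonneg (by positivity), div_le_iff₀ hpos]
  nlinarith

/-- If `c` is absorbed by `a`, and `b` is at distance less than `1` from `a`, then `c²` is Cuntz
subequivalent to any element `f` that can be compressed to `b²`. -/
theorem cuntzLE_of_norm_sub_lt_one {a b c f q : A} (ha : IsSelfAdjoint a) (hb : IsSelfAdjoint b)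
    (hc : IsSelfAdjoint c) (hca : c * a = c) (hbq : b * b = star q * f * q) (hab : ‖a - b‖ < 1) :
    CuntzLE (c * c) f := by
  obtain ⟨k, hk⟩ : ∃ k : Aˣ, (k : A) = 1 - (a - b) := ⟨Units.oneSub (a - b) hab, rfl⟩
  set j : A := ((k⁻¹ : Aˣ) : A)
  have hkj : (k : A) * j = 1 := k.mul_inv
  have hjk : j * (k : A) = 1 := k.inv_mul
  have hksa : star (k : A) = k := by
    rw [hk, star_sub, star_one, star_sub, ha.star_eq, hb.star_eq]
  have hjsa : star j = j := by
    calc star j = star j * ((k : A) * j) := by rw [hkj, mul_one]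
      _ = star ((k : A) * j) * j := by rw [star_mul, hksa, mul_assoc]
      _ = j := by rw [hkj, star_one, one_mul]
  have hck : c * k = c * b := by
    rw [hk, mul_sub, mul_sub, hca, mul_one]; noncomm_ring
  have hkc : (k : A) * c = b * c := by
    have := congrArg star hck
    simpa only [star_mul, hksa, hb.star_eq, hc.star_eq] using this
  set v : A := j * b with hv
  have hsv : star v = b * j := by rw [hv, star_mul, hb.star_eq, hjsa]
  set w : A := star v * v with hw
  have hcwc : c * w * c = c * c := by
    calc c * w * c = (c * b) * j * j * (b * c) := by rw [hw, hsv, hv]; noncomm_ring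
      _ = c * ((k : A) * j) * (j * k) * c := by rw [← hck, ← hkc]; noncomm_ring
      _ = c * c := by rw [hkj, hjk]; noncomm_ring
  choose h hsa hle using fun n : ℕ =>
    exists_norm_mul_sq_mul_sub_le (IsSelfAdjoint.star_mul_self v)
      spectrum_star_mul_self_nonneg (ε := 1 / ((n : ℝ) + 1)) (by positivity)
  refine ⟨fun n => q * j * v * h n * c, ?_⟩
  have key : ∀ n, star (q * j * v * h n * c) * f * (q * j * v * h n * c) - c * c =
      c * (h n * w * w * h n - w) * c := by
    intro n
    calc star (q * j * v * h n * c) * f * (q * j * v * h n * c) - c * c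
        = c * h n * star v * j * (star q * f * q) * j * v * h n * c - c * c := by
          simp only [star_mul, hjsa, (hsa n).star_eq, hc.star_eq, mul_assoc]
      _ = c * h n * star v * (j * b) * (b * j) * v * h n * c - c * w * c := by
          rw [← hbq, hcwc]; noncomm_ring
      _ = c * h n * (star v * v) * (star v * v) * h n * c - c * w * c := by
          rw [← hsv, ← hv]; noncomm_ring
      _ = _ := by rw [← hw]; noncomm_ring
  have hlim : Tendsto (fun n : ℕ => ‖c‖ * (1 / ((n : ℝ) + 1)) * ‖c‖) atTop (𝓝 0) := by
    simpa using (tendsto_one_div_add_atTop_nhds_zero_nat.const_mul ‖c‖).mul_const ‖c‖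
  refine squeeze_zero (fun _ => norm_nonneg _) (fun n => ?_) hlim
  rw [key n]
  exact (norm_mul₃_le).trans (by gcongr; exact hle n)

theorem isSelfAdjoint_cfc_ofReal (g : ℂ → ℝ) (x : A) :
    IsSelfAdjoint (cfc (fun z => (g z : ℂ)) x) := by
  rw [IsSelfAdjoint, ← cfc_star]
  simp

theorem cuntzLE_cfc_of_norm_sub_lt_one {x y : A} {f₁ f₂ g : ℂ → ℝ}
    (hf₁ : Continuous f₁) (hf₂ : Continuous f₂) (hg : Continuous g)
    (hf₁0 : ∀ z, 0 ≤ f₁ z) (hfg : ∀ z ∈ spectrum ℂ x, f₁ z ≠ 0 → g z = 1)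
    {m : ℝ} (hm : 0 < m) (hgf : ∀ z ∈ spectrum ℂ y, g z ≠ 0 → m ≤ f₂ z)
    (hlt : ‖cfc (fun z => (g z : ℂ)) x - cfc (fun z => (g z : ℂ)) y‖ < 1) :
    CuntzLE (cfc (fun z => (f₁ z : ℂ)) x) (cfc (fun z => (f₂ z : ℂ)) y) := by
  have hmax : ∀ z, 0 < max (f₂ z) m := fun z => lt_max_of_lt_right hm
  have hqc : Continuous fun z => ((g z / √(max (f₂ z) m) : ℝ) : ℂ) :=
    Complex.continuous_ofReal.comp
      (hg.div (by fun_prop) fun z => (Real.sqrt_pos.2 (hmax z)).ne')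
  have hsq : cfc (fun z => (f₁ z : ℂ)) x =
      cfc (fun z => ((√(f₁ z) : ℝ) : ℂ)) x * cfc (fun z => ((√(f₁ z) : ℝ) : ℂ)) x := by
    rw [← cfc_mul _ _ x (by fun_prop) (by fun_prop)]
    refine cfc_congr fun z _ => ?_
    simp only [← Complex.ofReal_mul, Real.mul_self_sqrt (hf₁0 z)]
  rw [hsq]
  refine cuntzLE_of_norm_sub_lt_one (q := cfc (fun z => ((g z / √(max (f₂ z) m) : ℝ) : ℂ)) y)
    (isSelfAdjoint_cfc_ofReal g x) (isSelfAdjoint_cfc_ofReal g y)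
    (isSelfAdjoint_cfc_ofReal _ x) ?_ ?_ hlt
  · rw [← cfc_mul _ _ x (by fun_prop) (by fun_prop)]
    refine cfc_congr fun z hz => ?_
    by_cases h0 : f₁ z = 0
    · simp [h0]
    · simp [hfg z hz h0]
  · rw [(isSelfAdjoint_cfc_ofReal _ y).star_eq, ← cfc_mul _ _ y (by fun_prop) (by fun_prop),
      ← cfc_mul _ _ y hqc.continuousOn (by fun_prop),
      ← cfc_mul _ _ y (by fun_prop) hqc.continuousOn]
    refine cfc_congr fun z hz => ?_
    simp only [← Complex.ofReal_mul]
    congr 1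
    by_cases h0 : g z = 0
    · simp [h0]
    · have hmf := hgf z hz h0
      have hf : 0 < f₂ z := hm.trans_le hmf
      rw [max_eq_left hmf]
      field_simp
      rw [Real.sq_sqrt hf.le]

/-- The real-valued function underlying `fOFun`. -/
noncomputable def fOReal (Ω O : Set ℂ) (z : ℂ) : ℝ := (min 1 (infEDist z (Ω \ O))).toReal

theorem fOApp_eq (Ω O : Set ℂ) (x : A) : fOApp Ω O x = cfc (fun z => (fOReal Ω O z : ℂ)) x := rfl

theorem continuous_fOReal (Ω O : Set ℂ) : Continuous (fOReal Ω O) := by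
  refine ENNReal.continuousOn_toReal.comp_continuous
    (continuous_const.min continuous_infEDist) fun z => ?_
  exact ne_top_of_le_ne_top ENNReal.one_ne_top (min_le_left _ _)

theorem fOReal_nonneg (Ω O : Set ℂ) (z : ℂ) : 0 ≤ fOReal Ω O z := ENNReal.toReal_nonneg

theorem mem_of_fOReal_ne_zero {Ω O : Set ℂ} {z : ℂ} (hz : z ∈ Ω) (h : fOReal Ω O z ≠ 0) :
    z ∈ O := by
  by_contra hO
  exact h (by simp [fOReal, infEDist_zero_of_mem (show z ∈ Ω \ O from ⟨hz, hO⟩)])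

theorem le_fOReal_thicken {Ω O : Set ℂ} {r : ℝ} {z : ℂ}
    (hz : infDist z O < r / 2) : min 1 (r / 2) ≤ fOReal Ω (thicken Ω O r) z := by
  have h : ENNReal.ofReal (r / 2) ≤ infEDist z (Ω \ thicken Ω O r) := by
    refine le_infEDist.2 fun w hw => ?_
    have hwr : r ≤ infDist w O := not_lt.1 fun hlt => hw.2 ⟨hw.1, hlt⟩
    rw [edist_dist]
    refine ENNReal.ofReal_le_ofReal ?_
    have := infDist_le_infDist_add_dist (s := O) (x := w) (y := z)
    rw [dist_comm]
    linarith
  have h2 : ENNReal.ofReal (min 1 (r / 2)) ≤ min 1 (infEDist z (Ω \ thicken Ω O r)) := by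
    refine le_min ?_ ((ENNReal.ofReal_le_ofReal (min_le_right _ _)).trans h)
    simp
  exact (ENNReal.ofReal_le_iff_le_toReal
    (ne_top_of_le_ne_top ENNReal.one_ne_top (min_le_left _ _))).1 h2

/-- A continuous bump equal to `1` within `δ` of `S` and to `0` at distance at least `2δ`. -/
noncomputable def plateau (S : Set ℂ) (δ : ℝ) (z : ℂ) : ℝ :=
  min 1 (max 0 (2 - infDist z S / δ))

theorem continuous_plateau (S : Set ℂ) (δ : ℝ) : Continuous (plateau S δ) := by
  unfold plateau
  have := continuous_infDist_pt S
  fun_prop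

theorem plateau_eq_one {S : Set ℂ} {δ : ℝ} (hδ : 0 < δ) {z : ℂ} (hz : infDist z S ≤ δ) :
    plateau S δ z = 1 := by
  have : infDist z S / δ ≤ 1 := (div_le_one hδ).2 hz
  exact min_eq_left (le_max_of_le_right (by linarith))

theorem infDist_lt_of_plateau_ne_zero {S : Set ℂ} {δ : ℝ} (hδ : 0 < δ) {z : ℂ}
    (hz : plateau S δ z ≠ 0) : infDist z S < 2 * δ := by
  by_contra! h
  have : 2 ≤ infDist z S / δ := (le_div_iff₀ hδ).2 h
  exact hz (by rw [plateau, max_eq_left (by linarith)]; simp)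

/-- Totally bounded sets admit finitely many plateau functions that separate every subset from
the complement of its thickening. -/
theorem exists_finset_plateau {Ω : Set ℂ} (hΩ : IsCompact Ω) {r : ℝ} (hr : 0 < r) :
    ∃ T : Finset ℂ, ∀ O ⊆ Ω, O.Nonempty → ∃ S ⊆ T, (∀ z ∈ O, plateau (S : Set ℂ) (r / 8) z = 1) ∧
      ∀ z, plateau (S : Set ℂ) (r / 8) z ≠ 0 → infDist z O < r / 2 := by
  classical
  have h8 : 0 < r / 8 := by positivity
  obtain ⟨t, ht, hcov⟩ := totallyBounded_iff.1 hΩ.totallyBounded (r / 8) h8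
  refine ⟨ht.toFinset, fun O hO hne => ?_⟩
  refine ⟨ht.toFinset.filter fun s => (ball s (r / 8) ∩ O).Nonempty, Finset.filter_subset _ _,
    ?_, ?_⟩
  · intro z hz
    obtain ⟨s, hs, hzs⟩ := Set.mem_iUnion₂.1 (hcov (hO hz))
    refine plateau_eq_one h8 ((infDist_le_dist_of_mem (y := s) ?_).trans (mem_ball.1 hzs).le)
    simpa only [Finset.coe_filter, Set.Finite.mem_toFinset, Set.mem_ofPred_eq] using
      (⟨hs, z, hzs, hz⟩ : s ∈ t ∧ (ball s (r / 8) ∩ O).Nonempty)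
  · intro z hz
    obtain ⟨z₀, hz₀⟩ := hne
    obtain ⟨s₀, hs₀, hzs₀⟩ := Set.mem_iUnion₂.1 (hcov (hO hz₀))
    have hlt := infDist_lt_of_plateau_ne_zero h8 hz
    obtain ⟨s, hs, hzs⟩ := (infDist_lt_iff ⟨s₀, by
      simpa only [Finset.coe_filter, Set.Finite.mem_toFinset, Set.mem_ofPred_eq] using
        (⟨hs₀, z₀, hzs₀, hz₀⟩ : s₀ ∈ t ∧ (ball s₀ (r / 8) ∩ O).Nonempty)⟩).1 hlt
    obtain ⟨o, hos, ho⟩ : (ball s (r / 8) ∩ O).Nonempty := by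
      simp only [Finset.coe_filter, Set.mem_ofPred_eq] at hs
      exact hs.2
    have h1 := infDist_le_dist_of_mem (x := z) ho
    have h2 := dist_triangle z s o
    have h3 := mem_ball'.1 hos
    linarith

theorem cuntzLE_fOApp_thicken {Ω O : Set ℂ} {r : ℝ} (hr : 0 < r) {x y : A} (hxΩ : spectrum ℂ x ⊆ Ω)
    {g : ℂ → ℝ} (hg : Continuous g) (hg1 : ∀ z ∈ O, g z = 1)
    (hg0 : ∀ z, g z ≠ 0 → infDist z O < r / 2)
    (hlt : ‖cfc (fun z => (g z : ℂ)) x - cfc (fun z => (g z : ℂ)) y‖ < 1) :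
    CuntzLE (fOApp Ω O x) (fOApp Ω (thicken Ω O r) y) :=
  cuntzLE_cfc_of_norm_sub_lt_one (continuous_fOReal _ _) (continuous_fOReal _ _) hg
    (fOReal_nonneg _ _) (fun z hz h => hg1 z (mem_of_fOReal_ne_zero (hxΩ hz) h))
    (lt_min one_pos (half_pos hr)) (fun z _ h => le_fOReal_thicken (hg0 z h)) hlt

theorem cuntzLE_fOApp_empty {Ω : Set ℂ} {x : A} (hxΩ : spectrum ℂ x ⊆ Ω) (b : A) :
    CuntzLE (fOApp Ω ∅ x) b := by
  have h : fOApp Ω ∅ x = 0 := by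
    rw [fOApp_eq, ← cfc_zero ℂ x]
    refine cfc_congr fun z hz => ?_
    have h0 : fOReal Ω ∅ z = 0 := by
      by_contra h
      exact mem_of_fOReal_ne_zero (hxΩ hz) h
    simp [h0]
  exact ⟨0, by simp [h]⟩

theorem fOApp_conj (Ω O : Set ℂ) {x : A} (hx : IsStarNormal x) (u : unitary A) :
    fOApp Ω O ((u : A) * x * star (u : A)) = (u : A) * fOApp Ω O x * star (u : A) := by
  have hux : IsStarNormal (Unitary.conjStarAlgAut ℂ A u x) := hx.map _
  have hφ : Continuous (Unitary.conjStarAlgAut ℂ A u) :=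
    (continuous_const.mul continuous_id).mul continuous_const
  have h := StarAlgHomClass.map_cfc (S := ℂ) (Unitary.conjStarAlgAut ℂ A u)
    (fun z => (fOReal Ω O z : ℂ)) x
    (Complex.continuous_ofReal.comp (continuous_fOReal Ω O)).continuousOn
    hφ hx hux
  exact h.symm

theorem exists_unitary_norm_lt_dU_add (x y : A) {ε : ℝ} (hε : 0 < ε) :
    ∃ u : unitary A, ‖(u : A) * x * star (u : A) - y‖ < dU x y + ε := by
  obtain ⟨_, ⟨u, rfl⟩, hu⟩ := exists_lt_of_csInf_lt
    (s := {d : ℝ | ∃ u : unitary A, d = ‖(u : A) * x * star (u : A) - y‖})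
    ⟨_, 1, rfl⟩ (lt_add_of_pos_right (dU x y) hε)
  exact ⟨u, hu⟩

/-- Let `A` be a unital C*-algebra and `Ω` a compact subset of `ℂ`.  Let `(xₙ)` be a sequence of
normal elements of `A` and `x` a normal element, all with spectra contained in `Ω`.
If `d_U(xₙ, x) → 0` then `d_W(xₙ, x) → 0`: for every `ε > 0` there is `N` with
`d_W(xₙ, x) < ε` for all `n ≥ N`. -/
theorem statement2 (Ω : Set ℂ) (hΩ : IsCompact Ω)
    (x : ℕ → A) (hxn : ∀ n, IsStarNormal (x n)) (hxsp : ∀ n, spectrum ℂ (x n) ⊆ Ω)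
    (y : A) (hy : IsStarNormal y) (hysp : spectrum ℂ y ⊆ Ω)
    (hdU : Tendsto (fun n => dU (x n) y) atTop (nhds 0)) :
    ∀ ε : ℝ, 0 < ε → ∃ N : ℕ, ∀ n ≥ N, dWNormal Ω (x n) y < ENNReal.ofReal ε := by
  intro ε hε
  set r := ε / 2
  have hr : 0 < r := half_pos hε
  obtain ⟨T, hT⟩ := exists_finset_plateau hΩ hr
  choose u hu using fun n : ℕ =>
    exists_unitary_norm_lt_dU_add (x n) y (ε := 1 / ((n : ℝ) + 1)) (by positivity)
  set x' : ℕ → A := fun n => (u n : A) * x n * star (u n : A)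
  have hx'n : ∀ n, IsStarNormal (x' n) := fun n =>
    (hxn n).map (Unitary.conjStarAlgAut ℂ A (u n))
  have hx'sp : ∀ n, spectrum ℂ (x' n) ⊆ Ω := fun n =>
    (AlgEquiv.spectrum_eq (Unitary.conjStarAlgAut ℂ A (u n)) (x n)).subset.trans (hxsp n)
  have hlim : Tendsto x' atTop (𝓝 y) := by
    rw [tendsto_iff_norm_sub_tendsto_zero]
    refine squeeze_zero (fun _ => norm_nonneg _) (fun n => (hu n).le) ?_
    simpa using hdU.add tendsto_one_div_add_atTop_nhds_zero_nat
  have hev : ∀ᶠ n in atTop, ∀ S ∈ T.powerset,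
      ‖cfc (fun z => (plateau (S : Set ℂ) (r / 8) z : ℂ)) (x' n) -
        cfc (fun z => (plateau (S : Set ℂ) (r / 8) z : ℂ)) y‖ < 1 := by
    refine (Finset.eventually_all _).2 fun S _ => ?_
    have h := Filter.Tendsto.cfc (𝕜 := ℂ) hΩ (fun z => (plateau (S : Set ℂ) (r / 8) z : ℂ)) hlim
      (Eventually.of_forall hx'sp) (Eventually.of_forall hx'n) hysp hy
      (Complex.continuous_ofReal.comp (continuous_plateau _ _)).continuousOn
    exact (tendsto_iff_norm_sub_tendsto_zero.1 h).eventually_lt_const one_pos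
  obtain ⟨N, hN⟩ := eventually_atTop.1 hev
  refine ⟨N, fun n hn => ?_⟩
  have hmem : dWNormal Ω (x n) y ≤ ENNReal.ofReal r := by
    refine sInf_le ⟨r, hr, rfl, ?_⟩
    rintro O ⟨U, -, hO⟩
    have hOΩ : O ⊆ Ω := hO ▸ Set.inter_subset_right
    rcases O.eq_empty_or_nonempty with rfl | hne
    · exact ⟨cuntzLE_fOApp_empty (hxsp n) _, cuntzLE_fOApp_empty hysp _⟩
    obtain ⟨S, hST, h1, h0⟩ := hT O hOΩ hne
    have hlt := hN n hn S (Finset.mem_powerset.2 hST)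
    have hg := continuous_plateau (S : Set ℂ) (r / 8)
    constructor
    · refine cuntzLE_conj_left (u n) ?_
      rw [← fOApp_conj Ω O (hxn n)]
      exact cuntzLE_fOApp_thicken hr (hx'sp n) hg h1 h0 hlt
    · refine cuntzLE_conj_right (u n) ?_
      rw [← fOApp_conj Ω _ (hxn n)]
      rw [norm_sub_rev] at hlt
      exact cuntzLE_fOApp_thicken hr hysp hg h1 h0 hlt
  exact hmem.trans_lt ((ENNReal.ofReal_lt_ofReal_iff hε).2 (half_lt_self hε))
end

section
/- Let A be a unital C*-algebra and Ω a compact subset of ℂ. Let (xₙ) be a sequence of normal elements of A with sp(xₙ) ⊆ Ω for all n, which is Cauchy with respect to d_U: for every ε > 0 there exists N such that d_U(xₙ, xₘ) < ε for all n, m ≥ N. Then there exists a normal element x ∈ A with sp(x) ⊆ Ω such that d_U(xₙ, x) → 0. -/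
open Filter Topology

variable {A : Type*} [CStarAlgebra A]

theorem dU_le_norm (x y : A) (u : unitary A) :
    dU x y ≤ ‖(u : A) * x * star (u : A) - y‖ :=
  csInf_le ⟨0, by rintro _ ⟨v, rfl⟩; exact norm_nonneg _⟩ ⟨u, rfl⟩

theorem dU_nonneg (x y : A) : 0 ≤ dU x y :=
  Real.sInf_nonneg (by rintro _ ⟨v, rfl⟩; exact norm_nonneg _)

theorem exists_norm_lt_of_dU_lt {x y : A} {ε : ℝ} (h : dU x y < ε) :
    ∃ u : unitary A, ‖(u : A) * x * star (u : A) - y‖ < ε := by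
  have hne : {d : ℝ | ∃ u : unitary A, d = ‖(u : A) * x * star (u : A) - y‖}.Nonempty :=
    ⟨_, 1, rfl⟩
  obtain ⟨_, ⟨u, rfl⟩, hu⟩ := exists_lt_of_csInf_lt hne h
  exact ⟨u, hu⟩

theorem norm_unitary_conj (u : unitary A) (a : A) :
    ‖(u : A) * a * star (u : A)‖ = ‖a‖ := by
  rw [← Unitary.coe_star, CStarRing.norm_mul_coe_unitary, CStarRing.norm_coe_unitary_mul]

theorem dU_triangle (x y z : A) : dU x z ≤ dU x y + dU y z := by
  refine le_of_forall_pos_lt_add fun ε hε => ?_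
  obtain ⟨u, hu⟩ := exists_norm_lt_of_dU_lt (x := x) (y := y) (ε := dU x y + ε / 2) (by linarith)
  obtain ⟨v, hv⟩ := exists_norm_lt_of_dU_lt (x := y) (y := z) (ε := dU y z + ε / 2) (by linarith)
  have h : ((v * u : unitary A) : A) * x * star ((v * u : unitary A) : A) - z =
      (v : A) * ((u : A) * x * star (u : A) - y) * star (v : A) +
        ((v : A) * y * star (v : A) - z) := by
    simp only [Submonoid.coe_mul, star_mul]
    noncomm_ring
  calc dU x z ≤ _ := dU_le_norm x z (v * u)
    _ ≤ ‖(u : A) * x * star (u : A) - y‖ + ‖(v : A) * y * star (v : A) - z‖ := by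
      rw [h]
      exact (norm_add_le _ _).trans_eq (by rw [norm_unitary_conj])
    _ < _ := by linarith

theorem isStarNormal_unitary_conj (u : unitary A) {x : A} (hx : IsStarNormal x) :
    IsStarNormal ((u : A) * x * star (u : A)) := by
  have := hx.map (Unitary.conjStarAlgAut ℂ A u)
  simpa [Unitary.conjStarAlgAut_apply] using this

theorem spectrum_unitary_conj (u : unitary A) (x : A) :
    spectrum ℂ ((u : A) * x * star (u : A)) = spectrum ℂ x := by
  simp

/-- A normal element whose spectrum has distance at
least `δ` from `z` has an invertible shift by `z`, even after a perturbation of norm less than `δ`. -/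
theorem isUnit_algebraMap_sub_of_norm_sub_lt {x y : A} (hx : IsStarNormal x) {z : ℂ} {δ : ℝ}
    (hδ : 0 < δ) (hz : ∀ w ∈ spectrum ℂ x, δ ≤ ‖z - w‖) (hy : ‖x - y‖ < δ) :
    IsUnit (algebraMap ℂ A z - y) := by
  nontriviality A
  have hne : ∀ w ∈ spectrum ℂ x, z - w ≠ 0 := fun w hw h0 => by
    have := hz w hw
    rw [h0, norm_zero] at this
    linarith
  have hc : ContinuousOn (fun w : ℂ => z - w) (spectrum ℂ x) := by fun_prop
  have hci : ContinuousOn (fun w : ℂ => (z - w)⁻¹) (spectrum ℂ x) := hc.inv₀ hne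
  have hsub : cfc (fun w : ℂ => z - w) x = algebraMap ℂ A z - x := by
    rw [cfc_sub (fun _ => z) (fun w => w) x, cfc_const z x, cfc_id' ℂ x]
  have hone : cfc (fun _ : ℂ => (1 : ℂ)) x = 1 := cfc_const_one ℂ x
  set b := cfc (fun w : ℂ => (z - w)⁻¹) x with hb
  have h1 : (algebraMap ℂ A z - x) * b = 1 := by
    rw [← hsub, hb, ← cfc_mul _ _ x hc hci, ← hone]
    exact cfc_congr fun w hw => mul_inv_cancel₀ (hne w hw)
  have h2 : b * (algebraMap ℂ A z - x) = 1 := by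
    rw [← hsub, hb, ← cfc_mul _ _ x hci hc, ← hone]
    exact cfc_congr fun w hw => inv_mul_cancel₀ (hne w hw)
  have hbn : ‖b‖ ≤ δ⁻¹ := norm_cfc_le (by positivity) fun w hw => by
    rw [norm_inv]
    exact inv_anti₀ hδ (hz w hw)
  let U : Aˣ := ⟨algebraMap ℂ A z - x, b, h1, h2⟩
  have hb0 : 0 < ‖b‖ := norm_pos_iff.2 (Units.ne_zero U⁻¹)
  refine (Units.ofNearby U (algebraMap ℂ A z - y) ?_).isUnit
  calc ‖algebraMap ℂ A z - y - (U : A)‖ = ‖x - y‖ := by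
        congr 1
        change algebraMap ℂ A z - y - (algebraMap ℂ A z - x) = x - y
        abel
    _ < δ := hy
    _ ≤ ‖b‖⁻¹ := by rw [le_inv_comm₀ hδ hb0]; exact hbn

/-- The spectra of normal elements contained in a fixed closed set remain there under norm
limits. -/
theorem spectrum_subset_of_tendsto {Ω : Set ℂ} (hΩ : IsClosed Ω) {x : ℕ → A} {y : A}
    (hxn : ∀ n, IsStarNormal (x n)) (hxsp : ∀ n, spectrum ℂ (x n) ⊆ Ω)
    (hy : Tendsto x atTop (𝓝 y)) : spectrum ℂ y ⊆ Ω := by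
  intro z hz
  by_contra hzΩ
  obtain ⟨δ, hδ, hball⟩ := Metric.isOpen_iff.1 hΩ.isOpen_compl z hzΩ
  obtain ⟨n, hn⟩ := (Metric.tendsto_nhds.1 hy δ hδ).exists
  refine hz (isUnit_algebraMap_sub_of_norm_sub_lt (hxn n) hδ (fun w hw => ?_)
    (by rwa [← dist_eq_norm]))
  by_contra! hlt
  exact hball (by rwa [Metric.mem_ball, dist_comm, dist_eq_norm]) (hxsp n hw)

/-- Let `A` be a unital C*-algebra and `Ω` a compact subset of `ℂ`.  Let `(xₙ)` be a sequence of
normal elements of `A` with `sp(xₙ) ⊆ Ω` for all `n`, Cauchy with respect to `d_U`.  Then there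
is a normal element `x` with `sp(x) ⊆ Ω` such that `d_U(xₙ, x) → 0`. -/
theorem statement4 (Ω : Set ℂ) (hΩ : IsCompact Ω)
    (x : ℕ → A) (hxn : ∀ n, IsStarNormal (x n)) (hxsp : ∀ n, spectrum ℂ (x n) ⊆ Ω)
    (hC : ∀ ε : ℝ, 0 < ε → ∃ N : ℕ, ∀ n ≥ N, ∀ m ≥ N, dU (x n) (x m) < ε) :
    ∃ y : A, IsStarNormal y ∧ spectrum ℂ y ⊆ Ω ∧
      Tendsto (fun n => dU (x n) y) atTop (nhds 0) := by
  obtain ⟨φ, hφ, hφC⟩ := extraction_forall_of_eventually'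
    (P := fun k N => ∀ n ≥ N, ∀ m ≥ N, dU (x n) (x m) < (1 / 2 : ℝ) ^ k) fun k => by
      obtain ⟨N, hN⟩ := hC ((1 / 2 : ℝ) ^ k) (by positivity)
      exact ⟨N, fun M hM n hn m hm => hN n (hM.trans hn) m (hM.trans hm)⟩
  choose u hu using fun k => exists_norm_lt_of_dU_lt
    (hφC k (φ (k + 1)) (hφ k.lt_succ_self).le (φ k) le_rfl)
  obtain ⟨v, hv⟩ : ∃ v : ℕ → unitary A, ∀ k, v (k + 1) = v k * u k :=
    ⟨fun k => Nat.rec 1 (fun k w => w * u k) k, fun _ => rfl⟩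
  let y : ℕ → A := fun k => (v k : A) * x (φ k) * star (v k : A)
  have hstep : ∀ k, dist (y k) (y (k + 1)) ≤ 1 * (1 / 2 : ℝ) ^ k := fun k => by
    have h : y (k + 1) - y k = (v k : A) *
        ((u k : A) * x (φ (k + 1)) * star (u k : A) - x (φ k)) * star (v k : A) := by
      simp only [y, hv, Submonoid.coe_mul, star_mul]
      noncomm_ring
    rw [dist_comm, dist_eq_norm, h, norm_unitary_conj, one_mul]
    exact (hu k).le
  obtain ⟨z, hz⟩ := cauchySeq_tendsto_of_complete
    (cauchySeq_of_le_geometric (1 / 2) 1 (by norm_num) hstep)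
  have hyn : ∀ k, IsStarNormal (y k) := fun k => isStarNormal_unitary_conj _ (hxn _)
  refine ⟨z, ?_, spectrum_subset_of_tendsto hΩ.isClosed hyn (fun k => ?_) hz, ?_⟩
  · exact ⟨tendsto_nhds_unique (hz.star.mul hz)
      ((hz.mul hz.star).congr fun k => ((hyn k).star_comm_self.eq).symm)⟩
  · exact (spectrum_unitary_conj _ _).trans_subset (hxsp _)
  · refine Metric.tendsto_atTop.2 fun ε hε => ?_
    obtain ⟨N, hN⟩ := hC (ε / 2) (half_pos hε)
    obtain ⟨k, hkN, hk⟩ := ((hφ.tendsto_atTop.eventually_ge_atTop N).and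
      (Metric.tendsto_nhds.1 hz (ε / 2) (half_pos hε))).exists
    refine ⟨N, fun n hn => ?_⟩
    rw [Real.dist_0_eq_abs, abs_of_nonneg (dU_nonneg _ _)]
    have h1 := dU_triangle (x n) (x (φ k)) z
    have h2 := hN n hn (φ k) hkN
    have h3 := dU_le_norm (x (φ k)) z (v k)
    rw [dist_eq_norm] at hk
    linarith
end

section
/- Let A be a separable, unital C*-algebra with stable rank one, and let q₁, …, qₙ and p be projections in A such that the diagonal matrix diag(q₁, …, qₙ) ∈ Mₙ(A) is Murray–von Neumann subequivalent to diag(p, 0, …, 0) ∈ Mₙ(A). Then there exist mutually orthogonal projections p₁, …, pₙ in A (pᵢ pⱼ = 0 for i ≠ j) such that pᵢ ∼ qᵢ for each i and p₁ + p₂ + ⋯ + pₙ ≤ p. -/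
/-- A projection in a *-ring: a self-adjoint idempotent. -/
def IsProjection {M : Type*} [Mul M] [Star M] (p : M) : Prop := star p = p ∧ p * p = p

/-- Murray–von Neumann equivalence: `a ∼ b` iff there is `x` with `x* x = a` and `x x* = b`. -/
def MvNEquiv {M : Type*} [Mul M] [Star M] (a b : M) : Prop :=
  ∃ x : M, star x * x = a ∧ x * star x = b

/-- Murray–von Neumann subequivalence: `a` is equivalent to a projection `q'` with `q' ≤ b`
(meaning `q' = q' b = b q'`). -/
def MvNSubequiv {M : Type*} [Mul M] [Star M] (a b : M) : Prop :=
  ∃ x q' : M, star x * x = a ∧ x * star x = q' ∧ IsProjection q' ∧ q' * b = q' ∧ b * q' = q'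

/-- If `a` is an idempotent subequivalent to `b`, the partial isometry `w` implementing this can be
chosen with `w a = w` and `b w = w`. -/
lemma MvNSubequiv.exists_mul_eq {M : Type*} [Semigroup M] [StarMul M] {a b : M}
    (h : MvNSubequiv a b) (ha : a * a = a) :
    ∃ w : M, star w * w = a ∧ w * a = w ∧ b * w = w := by
  obtain ⟨x, q', hx, hx', ⟨hs, hi⟩, -, hb⟩ := h
  refine ⟨q' * x, ?_, ?_, by rw [← mul_assoc, hb]⟩
  · calc star (q' * x) * (q' * x) = star x * ((q' * q') * x) := by
          rw [star_mul, hs]; simp only [mul_assoc]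
      _ = (star x * x) * (star x * x) := by rw [hi, ← hx']; simp only [mul_assoc]
      _ = a := by rw [hx, ha]
  · calc q' * x * a = q' * (x * star x) * x := by rw [← hx]; simp only [mul_assoc]
      _ = q' * x := by rw [hx', hi]

/-- Let `A` be a separable, unital C*-algebra with stable rank one, and let `q₁, …, qₙ` and `p`
be projections in `A` such that `diag(q₁, …, qₙ)` is Murray–von Neumann subequivalent to
`diag(p, 0, …, 0)` in `Mₙ(A)`.  Then there are mutually orthogonal projections `p₁, …, pₙ` in
`A` with `pᵢ ∼ qᵢ` for each `i` and `p₁ + ⋯ + pₙ ≤ p`. -/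
theorem statement5 {A : Type*} [CStarAlgebra A] [TopologicalSpace.SeparableSpace A]
    (hsr1 : Dense {a : A | IsUnit a})
    (n : ℕ) (q : Fin (n + 1) → A) (hq : ∀ i, IsProjection (q i))
    (p : A) (hp : IsProjection p)
    (hsub : MvNSubequiv (Matrix.diagonal q)
      (Matrix.diagonal (fun i : Fin (n + 1) => if i = 0 then p else 0))) :
    ∃ P : Fin (n + 1) → A,
      (∀ i, IsProjection (P i)) ∧
      (∀ i j, i ≠ j → P i * P j = 0) ∧
      (∀ i, MvNEquiv (P i) (q i)) ∧
      (∑ i, P i) * p = ∑ i, P i ∧ p * (∑ i, P i) = ∑ i, P i := by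
  have hqq : Matrix.diagonal q * Matrix.diagonal q = Matrix.diagonal q := by
    rw [Matrix.diagonal_mul_diagonal]
    exact congrArg Matrix.diagonal (funext fun i => (hq i).2)
  obtain ⟨w, hw, hwq, hpw⟩ := hsub.exists_mul_eq hqq
  have hrow : ∀ k, k ≠ 0 → ∀ i, w k i = 0 := fun k hk i => by
    simpa [Matrix.diagonal_mul, hk] using (congrFun (congrFun hpw k) i).symm
  have hpv : ∀ i, p * w 0 i = w 0 i := fun i => by
    simpa [Matrix.diagonal_mul] using congrFun (congrFun hpw 0) i
  have hvq : ∀ i, w 0 i * q i = w 0 i := fun i => by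
    simpa [Matrix.mul_diagonal] using congrFun (congrFun hwq 0) i
  have hvv : ∀ i j, star (w 0 i) * w 0 j = Matrix.diagonal q i j := fun i j => by
    rw [← hw, Matrix.mul_apply, Finset.sum_eq_single 0]
    · rfl
    · intro k _ hk
      rw [hrow k hk j, mul_zero]
    · simp
  have hvp : ∀ i, star (w 0 i) * p = star (w 0 i) := fun i => by
    simpa [hp.1] using congrArg star (hpv i)
  refine ⟨fun i => w 0 i * star (w 0 i), fun i => ⟨by simp, ?_⟩, fun i j hij => ?_,
    fun i => ⟨star (w 0 i), by simp, by simp [hvv]⟩, ?_, ?_⟩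
  · rw [mul_assoc, ← mul_assoc (star _), hvv, Matrix.diagonal_apply_eq, ← mul_assoc, hvq]
  · rw [mul_assoc, ← mul_assoc (star _), hvv, Matrix.diagonal_apply_ne _ hij, zero_mul, mul_zero]
  · simp only [Finset.sum_mul, mul_assoc, hvp]
  · simp only [Finset.mul_sum, ← mul_assoc, hpv]
end

section
/- Let A be a C*-algebra, let Ω be a compact subset of ℂ, and let φ, ψ : C(Ω, ℂ) → A be *-homomorphisms with d_W(φ, ψ) = 0. Then for every relatively open subset O ⊆ Ω, the positive elements φ(f_O) and ψ(f_O) are Cuntz equivalent. -/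
open Filter Topology
open scoped ENNReal

lemma continuous_fOFun (Ω O : Set ℂ) : Continuous (fOFun Ω O) := by
  apply Complex.continuous_ofReal.comp
  apply ENNReal.continuousOn_toReal.comp_continuous
    (continuous_const.min EMetric.continuous_infEdist)
  intro z
  exact ne_top_of_le_ne_top ENNReal.one_ne_top (min_le_left _ _)

/-- `f_O` as an element of `C(Ω, ℂ)`. -/
noncomputable def fO (Ω O : Set ℂ) : C(Ω, ℂ) :=
  ⟨fun z => fOFun Ω O z, (continuous_fOFun Ω O).comp continuous_subtype_val⟩

/-- The Cuntz distance `d_W` between two maps `C(Ω, ℂ) → A`, with values in `[0, ∞]`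
(the infimum of the empty set being `∞`). -/
noncomputable def dW {A : Type*} [NonUnitalNormedRing A] [StarRing A]
    (Ω : Set ℂ) (φ ψ : C(Ω, ℂ) → A) : ℝ≥0∞ :=
  sInf {e : ℝ≥0∞ | ∃ r : ℝ, 0 < r ∧ e = ENNReal.ofReal r ∧
    ∀ O : Set ℂ, RelOpen Ω O →
      CuntzLE (φ (fO Ω O)) (ψ (fO Ω (thicken Ω O r))) ∧
      CuntzLE (ψ (fO Ω O)) (φ (fO Ω (thicken Ω O r)))}

section CuntzComparison

variable {A : Type*} [NonUnitalCStarAlgebra A]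

lemma cuntzLE_iff_forall_exists {a b : A} :
    CuntzLE a b ↔ ∀ ε : ℝ, 0 < ε → ∃ r : A, ‖star r * b * r - a‖ < ε := by
  constructor
  · rintro ⟨r, hr⟩ ε hε
    obtain ⟨n, hn⟩ := (hr.eventually (gt_mem_nhds hε)).exists
    exact ⟨r n, hn⟩
  · intro h
    choose r hr using fun n : ℕ => h (1 / ((n : ℝ) + 1)) Nat.one_div_pos_of_nat
    exact ⟨r, squeeze_zero (fun _ => norm_nonneg _) (fun n => (hr n).le)
      tendsto_one_div_add_atTop_nhds_zero_nat⟩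

lemma CuntzLE.trans {a b c : A} (hab : CuntzLE a b) (hbc : CuntzLE b c) : CuntzLE a c := by
  rw [cuntzLE_iff_forall_exists] at *
  intro ε hε
  obtain ⟨r, hr⟩ := hab (ε / 2) (by positivity)
  obtain ⟨s, hs⟩ := hbc (ε / 2 / (‖r‖ * ‖r‖ + 1)) (by positivity)
  refine ⟨s * r, ?_⟩
  have heq : star (s * r) * c * (s * r) - a =
      star r * (star s * c * s - b) * r + (star r * b * r - a) := by
    rw [star_mul]
    noncomm_ring
  have hle : ‖star r * (star s * c * s - b) * r‖ ≤ ε / 2 := by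
    calc ‖star r * (star s * c * s - b) * r‖
        ≤ ‖star r‖ * ‖star s * c * s - b‖ * ‖r‖ := norm_mul₃_le
      _ = ‖star s * c * s - b‖ * (‖r‖ * ‖r‖) := by rw [norm_star]; ring
      _ ≤ ε / 2 / (‖r‖ * ‖r‖ + 1) * (‖r‖ * ‖r‖ + 1) := by
          gcongr
          linarith
      _ = ε / 2 := div_mul_cancel₀ _ (by positivity)
  rw [heq]
  linarith [norm_add_le (star r * (star s * c * s - b) * r) (star r * b * r - a)]

lemma cuntzLE_of_forall_norm_sub_le {a b : A}
    (h : ∀ ε : ℝ, 0 < ε → ∃ a' : A, ‖a' - a‖ ≤ ε ∧ CuntzLE a' b) : CuntzLE a b := by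
  rw [cuntzLE_iff_forall_exists]
  intro ε hε
  obtain ⟨a', ha, hab⟩ := h (ε / 2) (by positivity)
  obtain ⟨r, hr⟩ := cuntzLE_iff_forall_exists.mp hab (ε / 2) (by positivity)
  refine ⟨r, ?_⟩
  linarith [norm_sub_le_norm_sub_add_norm_sub (star r * b * r) a' a]

lemma cuntzLE_zero_left (b : A) : CuntzLE 0 b := ⟨0, by simp⟩

lemma CuntzLE.map {X : Type*} [TopologicalSpace X] [CompactSpace X] {a b : C(X, ℂ)}
    (h : CuntzLE a b) (φ : C(X, ℂ) →⋆ₙₐ[ℂ] A) : CuntzLE (φ a) (φ b) := by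
  obtain ⟨r, hr⟩ := h
  refine ⟨fun n => φ (r n), squeeze_zero (fun _ => norm_nonneg _) (fun n => ?_) hr⟩
  rw [← map_star, ← map_mul, ← map_mul, ← map_sub]
  exact NonUnitalStarAlgHom.norm_apply_le φ _

/-- Pointwise domination of nonnegative functions implies Cuntz subequivalence. -/
lemma cuntzLE_of_pointwise_le {X : Type*} [TopologicalSpace X] [CompactSpace X]
    {f g : C(X, ℂ)} {u v : X → ℝ} (hu : Continuous u) (hv : Continuous v)
    (hf : ∀ x, f x = u x) (hg : ∀ x, g x = v x) (h0 : ∀ x, 0 ≤ u x) (huv : ∀ x, u x ≤ v x) :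
    CuntzLE f g := by
  rw [cuntzLE_iff_forall_exists]
  intro ε hε
  have hpos : ∀ x, 0 < v x + ε / 2 := fun x => by linarith [h0 x, huv x]
  refine ⟨⟨fun x => (√(u x / (v x + ε / 2)) : ℝ), Complex.continuous_ofReal.comp
    (hu.div (hv.add continuous_const) fun x => (hpos x).ne').sqrt⟩, ?_⟩
  refine lt_of_le_of_lt ((ContinuousMap.norm_le _ (half_pos hε).le).mpr fun x => ?_)
    (half_lt_self hε)
  have hsq := Real.mul_self_sqrt (div_nonneg (h0 x) (hpos x).le)
  have hval : √(u x / (v x + ε / 2)) * v x * √(u x / (v x + ε / 2)) - u x =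
      -(ε / 2 * (u x / (v x + ε / 2))) := by
    rw [mul_right_comm, hsq]
    have hcancel : u x / (v x + ε / 2) * (v x + ε / 2) = u x := div_mul_cancel₀ _ (hpos x).ne'
    linarith
  have hle : u x / (v x + ε / 2) ≤ 1 := by
    rw [div_le_one (hpos x)]
    linarith [huv x]
  simp only [ContinuousMap.sub_apply, ContinuousMap.mul_apply, ContinuousMap.star_apply,
    ContinuousMap.coe_mk, hf, hg, Complex.star_def, Complex.conj_ofReal]
  rw [← Complex.ofReal_mul, ← Complex.ofReal_mul, ← Complex.ofReal_sub, Complex.norm_real, hval,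
    norm_neg, Real.norm_of_nonneg (by have := div_nonneg (h0 x) (hpos x).le; positivity)]
  exact mul_le_of_le_one_right (half_pos hε).le hle

end CuntzComparison

section SupportFunctions

/-- The real-valued function underlying `fOFun`. -/
noncomputable def truncDist (Ω O : Set ℂ) (z : ℂ) : ℝ :=
  (min 1 (Metric.infEDist z (Ω \ O))).toReal

variable {Ω O V : Set ℂ}

lemma fO_apply (z : Ω) : fO Ω O z = (truncDist Ω O z : ℂ) := rfl

lemma continuous_truncDist (Ω O : Set ℂ) : Continuous (truncDist Ω O) :=
  Complex.continuous_re.comp (continuous_fOFun Ω O)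

lemma min_one_infEDist_ne_top (S : Set ℂ) (z : ℂ) : min 1 (Metric.infEDist z S) ≠ ⊤ :=
  ne_top_of_le_ne_top ENNReal.one_ne_top (min_le_left _ _)

lemma truncDist_mono (h : V ⊆ O) (z : ℂ) : truncDist Ω V z ≤ truncDist Ω O z :=
  ENNReal.toReal_mono (min_one_infEDist_ne_top _ _)
    (min_le_min_left _ (Metric.infEDist_anti (Set.sdiff_subset_sdiff_right h)))

lemma cuntzLE_fO_of_subset [CompactSpace Ω] (h : V ⊆ O) : CuntzLE (fO Ω V) (fO Ω O) :=
  cuntzLE_of_pointwise_le ((continuous_truncDist Ω V).comp continuous_subtype_val)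
    ((continuous_truncDist Ω O).comp continuous_subtype_val) (fun _ => rfl) (fun _ => rfl)
    (fun _ => ENNReal.toReal_nonneg) (fun z => truncDist_mono h z)

lemma fO_empty : fO Ω ∅ = 0 := by
  ext z
  simp only [fO_apply, truncDist, Set.sdiff_empty, Metric.infEDist_zero_of_mem z.2]
  simp

/-- The points of `Ω` at distance more than `η` from `Ω \ O`. -/
def innerPart (Ω O : Set ℂ) (η : ℝ) : Set ℂ :=
  {x | ENNReal.ofReal η < Metric.infEDist x (Ω \ O)} ∩ Ω

lemma relOpen_innerPart (Ω O : Set ℂ) (η : ℝ) : RelOpen Ω (innerPart Ω O η) :=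
  ⟨_, isOpen_lt continuous_const Metric.continuous_infEDist, rfl⟩

lemma innerPart_subset (Ω O : Set ℂ) (η : ℝ) : innerPart Ω O η ⊆ O := by
  rintro x ⟨hx, hxΩ⟩
  by_contra hxO
  have hx0 : Metric.infEDist x (Ω \ O) = 0 := Metric.infEDist_zero_of_mem ⟨hxΩ, hxO⟩
  exact not_lt_zero (hx.trans_eq hx0)

lemma thicken_innerPart_subset {r η : ℝ} (hr : r ≤ η) (hne : (innerPart Ω O η).Nonempty) :
    thicken Ω (innerPart Ω O η) r ⊆ O := by
  rintro x ⟨hxΩ, hx⟩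
  by_contra hxO
  obtain ⟨y, hy, hxy⟩ := (Metric.infDist_lt_iff hne).mp hx
  have hle : Metric.infEDist y (Ω \ O) ≤ edist y x :=
    Metric.infEDist_le_edist_of_mem ⟨hxΩ, hxO⟩
  rw [edist_dist, dist_comm] at hle
  exact (hy.1.trans_le hle).not_ge (ENNReal.ofReal_le_ofReal (hxy.le.trans hr))

lemma truncDist_le_innerPart_add {η : ℝ} (hη : 0 ≤ η) (z : ℂ) :
    truncDist Ω O z ≤ truncDist Ω (innerPart Ω O η) z + η := by
  have hinf : Metric.infEDist z (Ω \ O) ≤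
      Metric.infEDist z (Ω \ innerPart Ω O η) + ENNReal.ofReal η := by
    rw [← tsub_le_iff_right, Metric.le_infEDist]
    rintro y ⟨hyΩ, hy⟩
    have hy' : Metric.infEDist y (Ω \ O) ≤ ENNReal.ofReal η := by
      by_contra! hlt
      exact hy ⟨hlt, hyΩ⟩
    rw [tsub_le_iff_right, add_comm]
    exact Metric.infEDist_le_infEDist_add_edist.trans (by gcongr)
  have hmin : min 1 (Metric.infEDist z (Ω \ O)) ≤
      min 1 (Metric.infEDist z (Ω \ innerPart Ω O η)) + ENNReal.ofReal η := by
    rw [← min_add_add_right]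
    exact min_le_min le_self_add hinf
  have htop := min_one_infEDist_ne_top (Ω \ innerPart Ω O η) z
  have := ENNReal.toReal_mono (ENNReal.add_ne_top.mpr ⟨htop, ENNReal.ofReal_ne_top⟩) hmin
  rwa [ENNReal.toReal_add htop ENNReal.ofReal_ne_top, ENNReal.toReal_ofReal hη] at this

lemma norm_fO_innerPart_sub_le [CompactSpace Ω] {η : ℝ} (hη : 0 ≤ η) :
    ‖fO Ω (innerPart Ω O η) - fO Ω O‖ ≤ η := by
  refine (ContinuousMap.norm_le _ hη).mpr fun z => ?_
  rw [ContinuousMap.sub_apply, fO_apply, fO_apply, ← Complex.ofReal_sub, Complex.norm_real,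
    Real.norm_eq_abs, abs_le]
  have hle : truncDist Ω O z ≤ _ := truncDist_le_innerPart_add hη z
  have hmono := truncDist_mono (Ω := Ω) (innerPart_subset Ω O η) z
  constructor <;> linarith

lemma cuntzLE_fO_of_forall_thicken {A : Type*} [NonUnitalCStarAlgebra A] [CompactSpace Ω]
    (φ ψ : C(Ω, ℂ) →⋆ₙₐ[ℂ] A)
    (h : ∀ η : ℝ, 0 < η → ∃ r ≤ η, ∀ V : Set ℂ, RelOpen Ω V →
      CuntzLE (φ (fO Ω V)) (ψ (fO Ω (thicken Ω V r)))) (O : Set ℂ) :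
    CuntzLE (φ (fO Ω O)) (ψ (fO Ω O)) := by
  refine cuntzLE_of_forall_norm_sub_le fun η hη => ⟨φ (fO Ω (innerPart Ω O η)), ?_, ?_⟩
  · rw [← map_sub]
    exact (NonUnitalStarAlgHom.norm_apply_le φ _).trans (norm_fO_innerPart_sub_le hη.le)
  · rcases (innerPart Ω O η).eq_empty_or_nonempty with he | hne
    · rw [he, fO_empty, map_zero]
      exact cuntzLE_zero_left _
    · obtain ⟨r, hr, hc⟩ := h η hη
      exact (hc _ (relOpen_innerPart Ω O η)).trans
        ((cuntzLE_fO_of_subset (thicken_innerPart_subset hr hne)).map ψ)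

end SupportFunctions

/-- Let `A` be a C*-algebra, `Ω` a compact subset of `ℂ`, and `φ, ψ : C(Ω, ℂ) → A`
*-homomorphisms with `d_W(φ, ψ) = 0`.  Then for every relatively open `O ⊆ Ω` the positive
elements `φ(f_O)` and `ψ(f_O)` are Cuntz equivalent. -/
theorem statement8 {A : Type*} [NonUnitalCStarAlgebra A]
    (Ω : Set ℂ) (hΩ : IsCompact Ω)
    (φ ψ : C(Ω, ℂ) →⋆ₙₐ[ℂ] A) (h : dW Ω ⇑φ ⇑ψ = 0) :
    ∀ O : Set ℂ, RelOpen Ω O →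
      CuntzLE (φ (fO Ω O)) (ψ (fO Ω O)) ∧ CuntzLE (ψ (fO Ω O)) (φ (fO Ω O)) := by
  have := isCompact_iff_compactSpace.mp hΩ
  have key : ∀ η : ℝ, 0 < η → ∃ r ≤ η, ∀ O : Set ℂ, RelOpen Ω O →
      CuntzLE (φ (fO Ω O)) (ψ (fO Ω (thicken Ω O r))) ∧
      CuntzLE (ψ (fO Ω O)) (φ (fO Ω (thicken Ω O r))) := by
    intro η hη
    have hlt : dW Ω ⇑φ ⇑ψ < ENNReal.ofReal η := by
      rw [h]
      exact ENNReal.ofReal_pos.mpr hη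
    obtain ⟨_, ⟨r, -, rfl, hO⟩, hrη⟩ := sInf_lt_iff.mp hlt
    exact ⟨r, ((ENNReal.ofReal_lt_ofReal_iff hη).mp hrη).le, hO⟩
  refine fun O _ => ⟨cuntzLE_fO_of_forall_thicken φ ψ (fun η hη => ?_) O,
    cuntzLE_fO_of_forall_thicken ψ φ (fun η hη => ?_) O⟩
  · obtain ⟨r, hr, hc⟩ := key η hη
    exact ⟨r, hr, fun V hV => (hc V hV).1⟩
  · obtain ⟨r, hr, hc⟩ := key η hη
    exact ⟨r, hr, fun V hV => (hc V hV).2⟩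
end
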